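/- Fix κ = (κ₀, κ₁, κ_t, κ_∞) ∈ ℂ⁴. Let U ⊆ ℂ∖{0,1} be open and let (q,p) : U → ℂ² be differentiable, solving the Hamiltonian system HS(κ₀, κ₁, κ_t, κ_∞) with q(t) ∉ {0, 1, t} for all t ∈ U. Then the pair (q, p − κ₀/q) solves the Hamiltonian system HS(−κ₀, κ₁, κ_t, κ_∞). (This is the sign-change symmetry (−,+,+,+) of Painlevé VI.) -/

import Mathlib

noncomputable section

/-- The auxiliary parameter ρ = (1 − κ₀ − κ₁ − κ_t − κ_∞)/2. -/
def pvRho (κ0 κ1 κt κinf : ℂ) : ℂ := (1 - κ0 - κ1 - κt - κinf) / 2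

/-- The Painlevé VI Hamiltonian
H(t,q,p) = [q(q−1)(q−t)/(t(t−1))]·(p² − (κ₀/q + κ₁/(q−1) + (κ_t−1)/(q−t))p
             + ρ(κ_∞+ρ)/(q(q−1))). -/
def pvH (κ0 κ1 κt κinf t q p : ℂ) : ℂ :=
  q * (q - 1) * (q - t) / (t * (t - 1)) *
    (p ^ 2 - (κ0 / q + κ1 / (q - 1) + (κt - 1) / (q - t)) * p +
      pvRho κ0 κ1 κt κinf * (κinf + pvRho κ0 κ1 κt κinf) / (q * (q - 1)))

/-- Partial derivative ∂H/∂p of the Hamiltonian. -/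
def pvHp (κ0 κ1 κt κinf t q p : ℂ) : ℂ := deriv (fun x => pvH κ0 κ1 κt κinf t q x) p

/-- Partial derivative ∂H/∂q of the Hamiltonian. -/
def pvHq (κ0 κ1 κt κinf t q p : ℂ) : ℂ := deriv (fun x => pvH κ0 κ1 κt κinf t x p) q

/-- `(q, p)` solves the non-autonomous Hamiltonian system
q' = ∂H/∂p, p' = −∂H/∂q on `U`. -/
def IsHamiltonianSol (κ0 κ1 κt κinf : ℂ) (U : Set ℂ) (q p : ℂ → ℂ) : Prop :=
  ∀ t ∈ U,
    HasDerivAt q (pvHp κ0 κ1 κt κinf t (q t) (p t)) t ∧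
    HasDerivAt p (-pvHq κ0 κ1 κt κinf t (q t) (p t)) t

/-- `lam` solves the Painlevé VI equation with parameters `(κ0, κ1, κt, κinf)` on `U`:
it avoids `0`, `1`, `t`, is twice differentiable, and satisfies the PVI ODE. -/
def IsPainleveVISol (κ0 κ1 κt κinf : ℂ) (U : Set ℂ) (lam : ℂ → ℂ) : Prop :=
  ∀ t ∈ U,
    lam t ≠ 0 ∧ lam t ≠ 1 ∧ lam t ≠ t ∧
    DifferentiableAt ℂ lam t ∧ DifferentiableAt ℂ (deriv lam) t ∧
    deriv (deriv lam) t =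
      1 / 2 * (1 / lam t + 1 / (lam t - 1) + 1 / (lam t - t)) * (deriv lam t) ^ 2
        - (1 / t + 1 / (t - 1) + 1 / (lam t - t)) * deriv lam t
        + lam t * (lam t - 1) * (lam t - t) / (t ^ 2 * (t - 1) ^ 2) *
            (κinf ^ 2 / 2 - κ0 ^ 2 / 2 * (t / (lam t) ^ 2)
              + κ1 ^ 2 / 2 * ((t - 1) / (lam t - 1) ^ 2)
              + (1 - κt ^ 2) / 2 * (t * (t - 1) / (lam t - t) ^ 2))

/-!
STATEMENT 16: If (q,p) is a differentiable solution of the Hamiltonian system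
HS(κ₀, κ₁, κ_t, κ_∞) on an open set U ⊆ ℂ∖{0,1} with q(t) ∉ {0,1,t}, then (q, p − κ₀/q)
solves the Hamiltonian system HS(−κ₀, κ₁, κ_t, κ_∞).
(Sign-change symmetry (−,+,+,+) of Painlevé VI.)
-/

/-- Away from `q = 0, 1, t` the Hamiltonian is a polynomial in `q` and `p`. -/
lemma pvH_eq_polynomial (κ0 κ1 κt κinf t q p : ℂ) (h0 : q ≠ 0) (h1 : q ≠ 1) (ht : q ≠ t) :
    pvH κ0 κ1 κt κinf t q p =
      (q * (q - 1) * (q - t) * p ^ 2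
        - (κ0 * ((q - 1) * (q - t)) + κ1 * (q * (q - t)) + (κt - 1) * (q * (q - 1))) * p
        + pvRho κ0 κ1 κt κinf * (κinf + pvRho κ0 κ1 κt κinf) * (q - t)) / (t * (t - 1)) := by
  have h1' := sub_ne_zero.mpr h1
  have ht' := sub_ne_zero.mpr ht
  unfold pvH
  rw [div_mul_eq_mul_div]
  congr 1
  field_simp

lemma pvHp_eq (κ0 κ1 κt κinf t q p : ℂ) (h0 : q ≠ 0) (h1 : q ≠ 1) (ht : q ≠ t) :
    pvHp κ0 κ1 κt κinf t q p =
      (2 * (q * (q - 1) * (q - t)) * p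
        - (κ0 * ((q - 1) * (q - t)) + κ1 * (q * (q - t)) + (κt - 1) * (q * (q - 1)))) /
        (t * (t - 1)) := by
  unfold pvHp
  simp only [pvH_eq_polynomial κ0 κ1 κt κinf t q _ h0 h1 ht]
  have hx := hasDerivAt_id' p
  refine HasDerivAt.deriv ?_
  refine HasDerivAt.congr_deriv (((((hx.pow 2).const_mul (q * (q - 1) * (q - t))).sub
    (hx.const_mul (κ0 * ((q - 1) * (q - t)) + κ1 * (q * (q - t)) +
      (κt - 1) * (q * (q - 1))))).add_const _).div_const (t * (t - 1))) ?_
  norm_num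
  ring

lemma pvHq_eq (κ0 κ1 κt κinf t q p : ℂ) (h0 : q ≠ 0) (h1 : q ≠ 1) (ht : q ≠ t) :
    pvHq κ0 κ1 κt κinf t q p =
      ((3 * q ^ 2 - 2 * (1 + t) * q + t) * p ^ 2
        - (κ0 * (2 * q - 1 - t) + κ1 * (2 * q - t) + (κt - 1) * (2 * q - 1)) * p
        + pvRho κ0 κ1 κt κinf * (κinf + pvRho κ0 κ1 κt κinf)) / (t * (t - 1)) := by
  unfold pvHq
  have heq : (fun x => pvH κ0 κ1 κt κinf t x p) =ᶠ[nhds q] fun x =>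
      (x * (x - 1) * (x - t) * p ^ 2
        - (κ0 * ((x - 1) * (x - t)) + κ1 * (x * (x - t)) + (κt - 1) * (x * (x - 1))) * p
        + pvRho κ0 κ1 κt κinf * (κinf + pvRho κ0 κ1 κt κinf) * (x - t)) / (t * (t - 1)) := by
    filter_upwards [eventually_ne_nhds h0, eventually_ne_nhds h1, eventually_ne_nhds ht]
      with x hx0 hx1 hxt
    exact pvH_eq_polynomial κ0 κ1 κt κinf t x p hx0 hx1 hxt
  rw [heq.deriv_eq]
  have hx := hasDerivAt_id' q
  have hx1 := hx.sub_const 1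
  have hxt := hx.sub_const t
  refine HasDerivAt.deriv ?_
  refine HasDerivAt.congr_deriv ((((((hx.mul hx1).mul hxt).mul_const (p ^ 2)).sub
    (((((hx1.mul hxt).const_mul κ0).add ((hx.mul hxt).const_mul κ1)).add
      ((hx.mul hx1).const_mul (κt - 1))).mul_const p)).add
    (hxt.const_mul (pvRho κ0 κ1 κt κinf * (κinf + pvRho κ0 κ1 κt κinf)))).div_const
      (t * (t - 1))) ?_
  simp only [Pi.mul_apply]
  ring

theorem sign_change_symmetry
    (κ0 κ1 κt κinf : ℂ) (U : Set ℂ) (hU : IsOpen U)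
    (hU01 : ∀ t ∈ U, t ≠ 0 ∧ t ≠ 1)
    (q p : ℂ → ℂ)
    (hsol : IsHamiltonianSol κ0 κ1 κt κinf U q p)
    (hreg : ∀ t ∈ U, q t ≠ 0 ∧ q t ≠ 1 ∧ q t ≠ t) :
    IsHamiltonianSol (-κ0) κ1 κt κinf U q (fun t => p t - κ0 / q t) := by
  intro t ht
  obtain ⟨hq, hp⟩ := hsol t ht
  obtain ⟨h0, h1, hqt⟩ := hreg t ht
  obtain ⟨ht0, ht1⟩ := hU01 t ht
  have ht1' := sub_ne_zero.mpr ht1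
  constructor
  · refine hq.congr_deriv ?_
    rw [pvHp_eq _ _ _ _ _ _ _ h0 h1 hqt, pvHp_eq _ _ _ _ _ _ _ h0 h1 hqt]
    field_simp
    ring
  · refine (hp.sub ((hasDerivAt_const t κ0).div hq h0)).congr_deriv ?_
    rw [pvHp_eq _ _ _ _ _ _ _ h0 h1 hqt, pvHq_eq _ _ _ _ _ _ _ h0 h1 hqt,
      pvHq_eq _ _ _ _ _ _ _ h0 h1 hqt]
    unfold pvRho
    field_simp
    ring
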